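/- arXiv:2004.07065 — 2 statements merged into one kernel-verified Lean document; each statement's English description precedes it below -/
import Mathlib

section
/- Let n ≥ 1, let t > 0, and let f : ℝⁿ → ℝ be a measurable function for which there exist constants C > 0 and a ≥ 0 with 0 < f(z) ≤ C·exp(a‖z‖) for all z ∈ ℝⁿ. Then the function ℝⁿ → ℝ given by x ↦ ln( ∫_{ℝⁿ} f(z)·(4πt)^{−n/2}·exp(−‖x−z‖²/(4t)) dz ) + ‖x‖²/(4t) is convex on ℝⁿ. -/
open MeasureTheory Real

/-- The integral of a family of positive log-convex functions is log-convex. -/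
theorem convexOn_log_integral {α E : Type*} [MeasurableSpace α] {μ : Measure α}
    [AddCommMonoid E] [Module ℝ E] {F : E → α → ℝ} (hpos : ∀ x z, 0 < F x z)
    (hint : ∀ x, Integrable (F x) μ) (hint_pos : ∀ x, 0 < ∫ z, F x z ∂μ)
    (hconv : ∀ z, ConvexOn ℝ Set.univ (fun x => Real.log (F x z))) :
    ConvexOn ℝ Set.univ (fun x => Real.log (∫ z, F x z ∂μ)) := by
  refine ⟨convex_univ, fun x _ y _ a b ha hb hab => ?_⟩
  simp only [smul_eq_mul]
  set A := ∫ z, F x z ∂μ with hA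
  set B := ∫ z, F y z ∂μ with hB
  have hA0 : 0 < A := hint_pos x
  have hB0 : 0 < B := hint_pos y
  rw [Real.log_le_iff_le_exp (hint_pos _)]
  set M := Real.exp (a * Real.log A + b * Real.log B) with hM
  have hle : ∀ z, F (a • x + b • y) z ≤ M * (a * (F x z / A) + b * (F y z / B)) := by
    intro z
    have h1 := (hconv z).2 (Set.mem_univ x) (Set.mem_univ y) ha hb hab
    simp only [smul_eq_mul] at h1
    have h2 := convexOn_exp.2 (Set.mem_univ (Real.log (F x z / A)))
      (Set.mem_univ (Real.log (F y z / B))) ha hb hab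
    simp only [smul_eq_mul] at h2
    rw [Real.exp_log (div_pos (hpos x z) hA0), Real.exp_log (div_pos (hpos y z) hB0)] at h2
    calc F (a • x + b • y) z ≤ Real.exp (a * Real.log (F x z) + b * Real.log (F y z)) :=
          (Real.log_le_iff_le_exp (hpos _ z)).1 h1
      _ = M * Real.exp (a * Real.log (F x z / A) + b * Real.log (F y z / B)) := by
          rw [hM, ← Real.exp_add, Real.log_div (hpos x z).ne' hA0.ne',
            Real.log_div (hpos y z).ne' hB0.ne']
          ring_nf
      _ ≤ _ := mul_le_mul_of_nonneg_left h2 (Real.exp_pos _).le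
  have hx : Integrable (fun z => a * (F x z / A)) μ := ((hint x).div_const A).const_mul a
  have hy : Integrable (fun z => b * (F y z / B)) μ := ((hint y).div_const B).const_mul b
  calc ∫ z, F (a • x + b • y) z ∂μ
      ≤ ∫ z, M * (a * (F x z / A) + b * (F y z / B)) ∂μ :=
        integral_mono (hint _) ((hx.add hy).const_mul M) hle
    _ = M := by
        rw [integral_const_mul, integral_add hx hy, integral_const_mul, integral_const_mul,
          integral_div, integral_div, ← hA, ← hB, div_self hA0.ne', div_self hB0.ne',
          mul_one, mul_one, hab, mul_one]

theorem integrable_exp_neg_mul_norm_sq {V : Type*} [NormedAddCommGroup V]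
    [InnerProductSpace ℝ V] [FiniteDimensional ℝ V] [MeasurableSpace V] [BorelSpace V]
    {b : ℝ} (hb : 0 < b) : Integrable (fun v : V => Real.exp (-b * ‖v‖ ^ 2)) := by
  have h := (GaussianFourier.integrable_cexp_neg_mul_sq_norm_add (V := V) (b := (b : ℂ))
    (by simpa using hb) 0 0).norm
  refine h.congr (Filter.Eventually.of_forall fun v => ?_)
  simp [Complex.norm_exp, ← Complex.ofReal_pow]

/-- A function of at most exponential growth is integrable against a Gaussian. -/
theorem integrable_mul_gaussian_of_le_exp {V : Type*} [NormedAddCommGroup V]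
    [InnerProductSpace ℝ V] [FiniteDimensional ℝ V] [MeasurableSpace V] [BorelSpace V]
    {f : V → ℝ} (hf : Measurable f) {C a t : ℝ} (ht : 0 < t) (hC : 0 ≤ C) (ha : 0 ≤ a)
    (hgrowth : ∀ z, ‖f z‖ ≤ C * Real.exp (a * ‖z‖)) (x : V) :
    Integrable (fun z => f z * Real.exp (-‖x - z‖ ^ 2 / (4 * t))) := by
  have hG : Integrable (fun z : V => Real.exp (-(1 / (8 * t)) * ‖x - z‖ ^ 2)) :=
    (integrable_exp_neg_mul_norm_sq (V := V) (b := 1 / (8 * t)) (by positivity)).comp_sub_left x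
  refine (hG.const_mul (C * Real.exp (a * ‖x‖ + 2 * t * a ^ 2))).mono' (by fun_prop)
    (Filter.Eventually.of_forall fun z => ?_)
  rw [norm_mul, Real.norm_of_nonneg (Real.exp_pos _).le]
  refine (mul_le_mul_of_nonneg_right (hgrowth z) (Real.exp_pos _).le).trans ?_
  rw [mul_assoc, mul_assoc, ← Real.exp_add, ← Real.exp_add]
  refine mul_le_mul_of_nonneg_left (Real.exp_le_exp.2 ?_) hC
  have hz : ‖z‖ ≤ ‖x‖ + ‖x - z‖ := by
    simpa using norm_sub_le x (x - z)
  have hsq : 2 * t * a ^ 2 - a * ‖x - z‖ + ‖x - z‖ ^ 2 / (8 * t)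
      = (4 * t * a - ‖x - z‖) ^ 2 / (8 * t) := by
    field_simp
    ring
  have hsq_nonneg : 0 ≤ (4 * t * a - ‖x - z‖) ^ 2 / (8 * t) := by positivity
  have hhalf : -‖x - z‖ ^ 2 / (4 * t) =
      -(1 / (8 * t)) * ‖x - z‖ ^ 2 - ‖x - z‖ ^ 2 / (8 * t) := by
    field_simp
    ring
  have := mul_le_mul_of_nonneg_left hz ha
  rw [hhalf]
  linarith

/-- For `f : ℝⁿ → ℝ` measurable with `0 < f(z) ≤ C·exp(a‖z‖)`, the function
`x ↦ ln(∫ f(z)·(4πt)^{-n/2}·exp(-‖x-z‖²/(4t)) dz) + ‖x‖²/(4t)` is convex. -/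
theorem log_heat_flow_plus_quadratic_convex
    (n : ℕ) (hn : 1 ≤ n) (t : ℝ) (ht : 0 < t)
    (f : EuclideanSpace ℝ (Fin n) → ℝ) (hf : Measurable f)
    (C a : ℝ) (hC : 0 < C) (ha : 0 ≤ a)
    (hgrowth : ∀ z, 0 < f z ∧ f z ≤ C * Real.exp (a * ‖z‖)) :
    ConvexOn ℝ Set.univ (fun x : EuclideanSpace ℝ (Fin n) =>
      Real.log (∫ z, f z * ((4 * Real.pi * t) ^ (-(n : ℝ) / 2) *
        Real.exp (-‖x - z‖ ^ 2 / (4 * t)))) + ‖x‖ ^ 2 / (4 * t)) := by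
  set c : ℝ := (4 * Real.pi * t) ^ (-(n : ℝ) / 2)
  have hc : 0 < c := by positivity
  have hpos : ∀ x z, 0 < f z * (c * Real.exp (-‖x - z‖ ^ 2 / (4 * t))) := fun x z =>
    mul_pos (hgrowth z).1 (by positivity)
  have hint : ∀ x, Integrable (fun z => f z * (c * Real.exp (-‖x - z‖ ^ 2 / (4 * t)))) := by
    intro x
    refine ((integrable_mul_gaussian_of_le_exp hf ht hC.le ha (fun z => ?_) x).const_mul c).congr
      (Filter.Eventually.of_forall fun z => mul_left_comm _ _ _)
    rw [Real.norm_of_nonneg (hgrowth z).1.le]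
    exact (hgrowth z).2
  have hint_pos : ∀ x, 0 < ∫ z, f z * (c * Real.exp (-‖x - z‖ ^ 2 / (4 * t))) := by
    intro x
    rw [integral_pos_iff_support_of_nonneg (fun z => (hpos x z).le) (hint x),
      Set.eq_univ_of_forall fun z => Function.mem_support.2 (hpos x z).ne']
    exact Measure.measure_univ_pos.2 (NeZero.ne _)
  have key := convexOn_log_integral (μ := volume)
    (F := fun x z => f z * (c * Real.exp (-‖x - z‖ ^ 2 / (4 * t))) * Real.exp (‖x‖ ^ 2 / (4 * t)))
    (fun x z => mul_pos (hpos x z) (Real.exp_pos _)) (fun x => (hint x).mul_const _)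
    (fun x => by
      rw [integral_mul_const]
      exact mul_pos (hint_pos x) (Real.exp_pos _))
    (fun z => by
      have hlog : ∀ x, Real.log (f z * (c * Real.exp (-‖x - z‖ ^ 2 / (4 * t))) *
          Real.exp (‖x‖ ^ 2 / (4 * t))) =
          (Real.log (f z) + Real.log c - ‖z‖ ^ 2 / (4 * t)) + inner ℝ z x / (2 * t) := by
        intro x
        rw [Real.log_mul (hpos x z).ne' (Real.exp_ne_zero _),
          Real.log_mul (hgrowth z).1.ne' (mul_pos hc (Real.exp_pos _)).ne',
          Real.log_mul hc.ne' (Real.exp_ne_zero _), Real.log_exp, Real.log_exp,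
          norm_sub_sq_real, real_inner_comm]
        field_simp
        ring
      refine ⟨convex_univ, fun x _ y _ p q _ _ hpq => le_of_eq ?_⟩
      simp only [hlog, inner_add_right, real_inner_smul_right, smul_eq_mul]
      linear_combination
        -(Real.log (f z) + Real.log c - ‖z‖ ^ 2 / (4 * t)) * hpq)
  refine key.congr fun x _ => ?_
  simp only [integral_mul_const]
  rw [Real.log_mul (hint_pos x).ne' (Real.exp_ne_zero _), Real.log_exp]
end

section
/- Let n, k ≥ 1, let 0 < t₁ < ⋯ < t_k, and let μ be the product heat kernel measure on (ℝⁿ)^k. Let f : (ℝⁿ)^k → ℝ be a positive C² function such that f and all of its first and second partial derivatives are bounded. Then for all real numbers a₁,…,a_k (with the convention a₀ = 0 and t₀ = 0) one has: ( Σ_{i,j=1}^k a_i·a_j·∫ Σ_{α=1}^n ∂²f/∂y_{i,α}∂y_{j,α}(y) dμ(y) ) / ( ∫ f dμ ) − ‖ Σ_{j=1}^k a_j·∫ ∇^{(j)}f dμ ‖² / ( ∫ f dμ )² + (n/2)·Σ_{j=1}^k (a_j − a_{j−1})²/(t_j − t_{j−1}) ≥ 0. -/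
open MeasureTheory Real

/-- The heat kernel on `ℝⁿ`, normalized so that the generator is the Laplacian. -/
noncomputable def heatKernel (n : ℕ) (t : ℝ) (x y : EuclideanSpace ℝ (Fin n)) : ℝ :=
  (4 * Real.pi * t) ^ (-(n : ℝ) / 2) * Real.exp (-‖x - y‖ ^ 2 / (4 * t))

/-- For a tuple indexed by `Fin k`, the previous value with the convention that the value at
index `0` is `0`. -/
def prevVal {k : ℕ} {α : Type*} [Zero α] (x : Fin k → α) (j : Fin k) : α :=
  if _ : (j : ℕ) = 0 then 0
  else x ⟨(j : ℕ) - 1, lt_of_le_of_lt (Nat.sub_le _ _) j.isLt⟩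

/-- The density of the product heat kernel measure on `(ℝⁿ)^k`. -/
noncomputable def heatDensity (n k : ℕ) (t : Fin k → ℝ)
    (y : Fin k → EuclideanSpace ℝ (Fin n)) : ℝ :=
  ∏ j : Fin k, heatKernel n (t j - prevVal t j) (prevVal y j) (y j)

/-- The product heat kernel measure `μ` on `(ℝⁿ)^k`. -/
noncomputable def heatMeasure (n k : ℕ) (t : Fin k → ℝ) :
    Measure (Fin k → EuclideanSpace ℝ (Fin n)) :=
  MeasureTheory.volume.withDensity (fun y => ENNReal.ofReal (heatDensity n k t y))

/-- The gradient `∇^{(j)} f (y) ∈ ℝⁿ` of `f : (ℝⁿ)^k → ℝ` with respect to its `j`-th variable. -/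
noncomputable def partialGrad (n k : ℕ) (f : (Fin k → EuclideanSpace ℝ (Fin n)) → ℝ)
    (j : Fin k) (y : Fin k → EuclideanSpace ℝ (Fin n)) : EuclideanSpace ℝ (Fin n) :=
  gradient (fun z => f (Function.update y j z)) (y j)

/-- The mixed second derivative `∇²_{(i)(j)} f(y)(v,w)` of `f : (ℝⁿ)^k → ℝ`, taken in
direction `v` in the `i`-th variable and `w` in the `j`-th variable. -/
noncomputable def partialHess (n k : ℕ) (f : (Fin k → EuclideanSpace ℝ (Fin n)) → ℝ)
    (i j : Fin k) (y : Fin k → EuclideanSpace ℝ (Fin n))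
    (v w : EuclideanSpace ℝ (Fin n)) : ℝ :=
  iteratedFDeriv ℝ 2 f y ![Pi.single i v, Pi.single j w]

/-- Polynomial factors of degree two are absorbed by a Gaussian. -/
lemma integrable_one_add_norm_sq_mul_exp_neg_sq {E : Type*} [NormedAddCommGroup E]
    [NormedSpace ℝ E] [FiniteDimensional ℝ E] [MeasurableSpace E] [BorelSpace E]
    (μ : Measure E) [μ.IsAddHaarMeasure] {ε : ℝ} (hε : 0 < ε) :
    Integrable (fun y : E => (1 + ‖y‖) ^ 2 * exp (-(ε * ‖y‖ ^ 2))) μ := by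
  set d := Module.finrank ℝ E
  have hint : Integrable (fun y : E => (1 + ‖y‖) ^ (-((d : ℝ) + 1))) μ :=
    integrable_one_add_norm (by simp [d])
  refine (hint.const_mul (exp (1 / (4 * ε) + 1) * (d + 3).factorial)).mono'
    (by fun_prop) (.of_forall fun y => ?_)
  have hx : 0 < 1 + ‖y‖ := by positivity
  have hrpow : (1 + ‖y‖) ^ (-((d : ℝ) + 1)) = ((1 + ‖y‖) ^ (d + 1))⁻¹ := by
    rw [rpow_neg hx.le]
    norm_cast
  have hexp : exp (-(ε * ‖y‖ ^ 2)) ≤ exp (1 / (4 * ε) + 1) * (exp (1 + ‖y‖))⁻¹ := by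
    rw [← exp_neg, ← exp_add, exp_le_exp]
    have : 1 / (4 * ε) - ‖y‖ + ε * ‖y‖ ^ 2 = (2 * ε * ‖y‖ - 1) ^ 2 / (4 * ε) := by
      field_simp
      ring
    have : 0 ≤ (2 * ε * ‖y‖ - 1) ^ 2 / (4 * ε) := by positivity
    linarith
  have hfac : (exp (1 + ‖y‖))⁻¹ ≤ (d + 3).factorial * ((1 + ‖y‖) ^ (d + 3))⁻¹ := by
    have := pow_div_factorial_le_exp (1 + ‖y‖) hx.le (d + 3)
    calc (exp (1 + ‖y‖))⁻¹ ≤ ((1 + ‖y‖) ^ (d + 3) / (d + 3).factorial)⁻¹ := by gcongr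
      _ = _ := by rw [inv_div, div_eq_mul_inv]
  rw [norm_of_nonneg (by positivity), hrpow]
  calc (1 + ‖y‖) ^ 2 * exp (-(ε * ‖y‖ ^ 2))
      ≤ (1 + ‖y‖) ^ 2 * (exp (1 / (4 * ε) + 1) *
          ((d + 3).factorial * ((1 + ‖y‖) ^ (d + 3))⁻¹)) := by gcongr; exact hexp.trans (by gcongr)
    _ = _ := by
      field_simp
      ring

/-- A continuous function of at most quadratic growth is integrable against a density of Gaussian
decay. -/
lemma Continuous.integrable_mul_of_quadratic_growth {E : Type*} [NormedAddCommGroup E]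
    [NormedSpace ℝ E] [FiniteDimensional ℝ E] [MeasurableSpace E] [BorelSpace E]
    {μ : Measure E} [μ.IsAddHaarMeasure] {g : E → ℝ} (hg : Continuous g) {ρ : E → ℝ}
    (hρ : Continuous ρ) {C ε : ℝ} (hε : 0 < ε)
    (hdecay : ∀ y, |ρ y| ≤ C * exp (-(ε * ‖y‖ ^ 2))) {A : ℝ}
    (hgrowth : ∀ y, |g y| ≤ A * (1 + ‖y‖) ^ 2) :
    Integrable (fun y => g y * ρ y) μ := by
  refine ((integrable_one_add_norm_sq_mul_exp_neg_sq μ hε).const_mul (A * C)).mono'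
    (hg.mul hρ).aestronglyMeasurable (.of_forall fun y => ?_)
  rw [norm_mul, norm_eq_abs, norm_eq_abs]
  calc |g y| * |ρ y| ≤ (A * (1 + ‖y‖) ^ 2) * (C * exp (-(ε * ‖y‖ ^ 2))) :=
        mul_le_mul (hgrowth y) (hdecay y) (abs_nonneg _) ((abs_nonneg _).trans (hgrowth y))
    _ = _ := by ring

/-- The Harnack-type inequality for one constant direction `v`: for a density `ρ` of Gaussian decay
whose logarithmic derivative along `v` is a linear functional `-L`, the expression below is the
variance of `L` under the probability measure proportional to `f ρ`. -/
lemma directional_harnack_of_gaussian_decay {E : Type*} [NormedAddCommGroup E]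
    [NormedSpace ℝ E] [FiniteDimensional ℝ E] [MeasurableSpace E] [BorelSpace E]
    (μ : Measure E) [μ.IsAddHaarMeasure] {ρ : E → ℝ} (hρ : Differentiable ℝ ρ)
    (hρpos : ∀ y, 0 < ρ y) {C ε : ℝ} (hε : 0 < ε)
    (hdecay : ∀ y, |ρ y| ≤ C * exp (-(ε * ‖y‖ ^ 2)))
    (v : E) (L : E →L[ℝ] ℝ) (hL : ∀ y, fderiv ℝ ρ y v = -(L y * ρ y))
    {f : E → ℝ} (hf : ContDiff ℝ 2 f) (hfpos : ∀ y, 0 < f y) {M : ℝ}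
    (hM0 : ∀ y, |f y| ≤ M) (hM1 : ∀ y, ‖fderiv ℝ f y‖ ≤ M)
    (hM2 : ∀ y, ‖iteratedFDeriv ℝ 2 f y‖ ≤ M) :
    0 ≤ (∫ y, iteratedFDeriv ℝ 2 f y ![v, v] * ρ y ∂μ) / (∫ y, f y * ρ y ∂μ)
      - (∫ y, fderiv ℝ f y v * ρ y ∂μ) ^ 2 / (∫ y, f y * ρ y ∂μ) ^ 2 + L v := by
  have hM : 0 ≤ M := (abs_nonneg _).trans (hM0 0)
  have hf1 : ContDiff ℝ 1 (fderiv ℝ f) := hf.fderiv_right (by norm_num)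
  have hD1 : ContDiff ℝ 1 (fun y => fderiv ℝ f y v) := hf1.clm_apply contDiff_const
  have hD2 : ∀ y, fderiv ℝ (fun y => fderiv ℝ f y v) y v = iteratedFDeriv ℝ 2 f y ![v, v] := by
    intro y
    rw [iteratedFDeriv_two_apply, fderiv_clm_apply (hf1.differentiable (by norm_num) y)
      (differentiableAt_const v)]
    simp
  have hD2c : Continuous (fun y => iteratedFDeriv ℝ 2 f y ![v, v]) :=
    (hf.continuous_iteratedFDeriv le_rfl).eval_const _
  have hfb : ∀ y, |fderiv ℝ f y v| ≤ M * ‖v‖ := fun y =>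
    ((fderiv ℝ f y).le_opNorm v).trans (by gcongr; exact hM1 y)
  have hfb2 : ∀ y, |iteratedFDeriv ℝ 2 f y ![v, v]| ≤ M * (‖v‖ * ‖v‖) := fun y => by
    refine ((iteratedFDeriv ℝ 2 f y).le_opNorm _).trans ?_
    simp only [Fin.prod_univ_two, Matrix.cons_val_zero, Matrix.cons_val_one]
    gcongr
    exact hM2 y
  have hLb : ∀ y, |L y| ≤ ‖L‖ * (1 + ‖y‖) := fun y =>
    (L.le_opNorm y).trans (by gcongr; linarith)
  have hone : ∀ y : E, 1 ≤ 1 + ‖y‖ := fun y => by linarith [norm_nonneg y]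
  have int0 : ∀ {g : E → ℝ} {A : ℝ}, Continuous g → 0 ≤ A → (∀ y, |g y| ≤ A) →
      Integrable (fun y => g y * ρ y) μ := fun hg hA h =>
    hg.integrable_mul_of_quadratic_growth hρ.continuous hε hdecay (A := _)
      fun y => (h y).trans (le_mul_of_one_le_right hA (one_le_pow₀ (hone y)))
  have int1 : ∀ {g : E → ℝ} {A : ℝ}, Continuous g → 0 ≤ A → (∀ y, |g y| ≤ A) →
      Integrable (fun y => g y * (L y * ρ y)) μ := fun {g A} hg hA h => by
    simp only [← mul_assoc]
    refine (hg.mul L.continuous).integrable_mul_of_quadratic_growth hρ.continuous hε hdecay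
      (A := A * ‖L‖) fun y => ?_
    rw [Pi.mul_apply, abs_mul]
    calc |g y| * |L y| ≤ A * (‖L‖ * (1 + ‖y‖)) := mul_le_mul (h y) (hLb y) (abs_nonneg _) hA
      _ ≤ A * (‖L‖ * (1 + ‖y‖) ^ 2) := by gcongr; exact le_self_pow₀ (hone y) two_ne_zero
      _ = _ := by ring
  have hI0 : Integrable (fun y => f y * ρ y) μ := int0 hf.continuous hM hM0
  have hI1 : Integrable (fun y => f y * (L y * ρ y)) μ := int1 hf.continuous hM hM0
  have hI2 : Integrable (fun y => f y * (L y ^ 2 * ρ y)) μ := by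
    simp only [← mul_assoc]
    refine (hf.continuous.mul (L.continuous.pow 2)).integrable_mul_of_quadratic_growth
      hρ.continuous hε hdecay (A := M * ‖L‖ ^ 2) fun y => ?_
    rw [Pi.mul_apply, Pi.pow_apply, abs_mul, abs_pow]
    calc |f y| * |L y| ^ 2 ≤ M * (‖L‖ * (1 + ‖y‖)) ^ 2 := by
          gcongr
          exacts [hM0 y, hLb y]
      _ = _ := by ring
  have hLρ : ∀ y, fderiv ℝ (fun y => L y * ρ y) y v = L v * ρ y - L y ^ 2 * ρ y := by
    intro y
    rw [fderiv_fun_mul L.differentiableAt (hρ y)]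
    simp [hL]
    ring
  have ibp1 : ∫ y, fderiv ℝ f y v * ρ y ∂μ = ∫ y, f y * (L y * ρ y) ∂μ := by
    have := integral_mul_fderiv_eq_neg_fderiv_mul_of_integrable (μ := μ) (f := f) (g := ρ) (v := v)
      (int0 hD1.continuous (by positivity) hfb)
      (by simp only [hL, mul_neg]; exact hI1.neg) hI0 (fun y _ => hf.differentiable (by norm_num) y) (fun y _ => hρ y)
    simp only [hL, mul_neg, integral_neg] at this
    linarith
  have ibp2 : ∫ y, iteratedFDeriv ℝ 2 f y ![v, v] * ρ y ∂μ
      = ∫ y, fderiv ℝ f y v * (L y * ρ y) ∂μ := by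
    have := integral_mul_fderiv_eq_neg_fderiv_mul_of_integrable (μ := μ)
      (f := fun y => fderiv ℝ f y v) (g := ρ) (v := v)
      (by simpa only [hD2] using int0 hD2c (by positivity) hfb2)
      (by simp only [hL, mul_neg]; exact (int1 hD1.continuous (by positivity) hfb).neg)
      (int0 hD1.continuous (by positivity) hfb) (fun y _ => hD1.differentiable (by norm_num) y) (fun y _ => hρ y)
    simp only [hL, hD2, mul_neg, integral_neg] at this
    linarith
  have hsplit : ∀ y, f y * (L v * ρ y - L y ^ 2 * ρ y)
      = L v * (f y * ρ y) - f y * (L y ^ 2 * ρ y) := fun y => by ring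
  have ibp3 : ∫ y, fderiv ℝ f y v * (L y * ρ y) ∂μ
      = ∫ y, f y * (L y ^ 2 * ρ y) ∂μ - L v * ∫ y, f y * ρ y ∂μ := by
    have := integral_mul_fderiv_eq_neg_fderiv_mul_of_integrable (μ := μ)
      (f := f) (g := fun y => L y * ρ y) (v := v)
      (int1 hD1.continuous (by positivity) hfb)
      (by simp only [hLρ, hsplit]; exact (hI0.const_mul (L v)).sub hI2)
      hI1 (fun y _ => hf.differentiable (by norm_num) y) (fun y _ => L.differentiableAt.mul (hρ y))
    simp only [hLρ, hsplit] at this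
    rw [integral_sub (hI0.const_mul _) hI2, integral_const_mul] at this
    linarith
  have hZ : 0 < ∫ y, f y * ρ y ∂μ :=
    integral_pos_of_integrable_nonneg_nonzero (x := 0) (hf.continuous.mul hρ.continuous) hI0
      (fun y => (mul_pos (hfpos y) (hρpos y)).le) (mul_pos (hfpos 0) (hρpos 0)).ne'
  rw [ibp2, ibp3, ibp1]
  set Z := ∫ y, f y * ρ y ∂μ
  set S₁ := ∫ y, f y * (L y * ρ y) ∂μ
  set S₂ := ∫ y, f y * (L y ^ 2 * ρ y) ∂μ
  have hvar : 0 ≤ S₂ - 2 * (S₁ / Z) * S₁ + (S₁ / Z) ^ 2 * Z := by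
    calc 0 ≤ ∫ y, f y * ρ y * (L y - S₁ / Z) ^ 2 ∂μ :=
          integral_nonneg fun y => mul_nonneg (mul_pos (hfpos y) (hρpos y)).le (sq_nonneg _)
      _ = ∫ y, f y * (L y ^ 2 * ρ y) - 2 * (S₁ / Z) * (f y * (L y * ρ y))
            + (S₁ / Z) ^ 2 * (f y * ρ y) ∂μ := by
          congr 1 with y
          ring
      _ = _ := by
          rw [integral_add (by exact hI2.sub (hI1.const_mul _)) (hI0.const_mul _),
            integral_sub hI2 (hI1.const_mul _), integral_const_mul, integral_const_mul]
  have : (S₂ - L v * Z) / Z - S₁ ^ 2 / Z ^ 2 + L v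
      = (S₂ - 2 * (S₁ / Z) * S₁ + (S₁ / Z) ^ 2 * Z) / Z := by
    field_simp
    ring
  rw [this]
  positivity

/-- The increment `y_j - y_{j-1}` (with `y_0 = 0`) as a continuous linear map. -/
noncomputable def increment (n k : ℕ) (j : Fin k) :
    (Fin k → EuclideanSpace ℝ (Fin n)) →L[ℝ] EuclideanSpace ℝ (Fin n) :=
  ContinuousLinearMap.proj j - if _ : (j : ℕ) = 0 then 0 else
    ContinuousLinearMap.proj ⟨(j : ℕ) - 1, lt_of_le_of_lt (Nat.sub_le _ _) j.isLt⟩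

lemma increment_apply (n k : ℕ) (j : Fin k) (y : Fin k → EuclideanSpace ℝ (Fin n)) :
    increment n k j y = y j - prevVal y j := by
  unfold increment prevVal
  split_ifs <;> simp

lemma increment_smul_const (n k : ℕ) (j : Fin k) (a : Fin k → ℝ) (w : EuclideanSpace ℝ (Fin n)) :
    increment n k j (fun i => a i • w) = (a j - prevVal a j) • w := by
  rw [increment_apply]
  unfold prevVal
  split_ifs <;> simp [sub_smul]

lemma eq_zero_of_increment_eq_zero {n k : ℕ} {y : Fin k → EuclideanSpace ℝ (Fin n)}
    (h : ∀ j, increment n k j y = 0) : y = 0 := by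
  suffices ∀ (m : ℕ) (hm : m < k), y ⟨m, hm⟩ = 0 from funext fun j => this j j.isLt
  intro m
  induction m with
  | zero =>
    intro hm
    simpa [increment_apply, prevVal] using h ⟨0, hm⟩
  | succ m ih =>
    intro hm
    simpa [increment_apply, prevVal, ih (by omega)] using h ⟨m + 1, hm⟩

/-- The sum of squared increments controls the squared norm. -/
lemma exists_norm_sq_le_sum_increment_sq (n k : ℕ) :
    ∃ c : ℝ, 0 < c ∧ ∀ y, c * ‖y‖ ^ 2 ≤ ∑ j, ‖increment n k j y‖ ^ 2 := by
  let D : (Fin k → EuclideanSpace ℝ (Fin n)) →L[ℝ] (Fin k → EuclideanSpace ℝ (Fin n)) :=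
    ContinuousLinearMap.pi (increment n k)
  obtain ⟨K, hK, hD⟩ := LinearMap.exists_antilipschitzWith D.toLinearMap
    (LinearMap.ker_eq_bot'.2 fun y hy => eq_zero_of_increment_eq_zero fun j => congrFun hy j)
  have hK' : (0 : ℝ) < K := hK
  refine ⟨((K : ℝ) ^ 2)⁻¹, by positivity, fun y => ?_⟩
  have h1 : ‖y‖ ≤ K * ‖D y‖ := by simpa using hD.le_mul_dist y 0
  have h2 : ‖D y‖ ≤ √(∑ j, ‖increment n k j y‖ ^ 2) := by
    refine (pi_norm_le_iff_of_nonneg (by positivity)).2 fun j => le_sqrt_of_sq_le ?_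
    exact Finset.single_le_sum (f := fun j => ‖increment n k j y‖ ^ 2)
      (fun i _ => by positivity) (Finset.mem_univ j)
  have h3 : ‖y‖ ^ 2 ≤ (K : ℝ) ^ 2 * ∑ j, ‖increment n k j y‖ ^ 2 := by
    calc ‖y‖ ^ 2 ≤ (K * √(∑ j, ‖increment n k j y‖ ^ 2)) ^ 2 := by
          gcongr
          exact h1.trans (by gcongr)
      _ = _ := by rw [mul_pow, sq_sqrt (by positivity)]
  rw [inv_mul_le_iff₀ (by positivity)]
  exact h3

lemma sub_prevVal_pos {k : ℕ} {t : Fin k → ℝ} (hmono : StrictMono t) (hpos : ∀ j, 0 < t j)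
    (j : Fin k) : 0 < t j - prevVal t j := by
  unfold prevVal
  split_ifs with h
  · simpa using hpos j
  · exact sub_pos.2 (hmono (Fin.lt_def.2 (Nat.sub_lt (Nat.pos_of_ne_zero h) one_pos)))

lemma heatDensity_eq (n k : ℕ) (t : Fin k → ℝ) (y : Fin k → EuclideanSpace ℝ (Fin n)) :
    heatDensity n k t y = (∏ j, (4 * π * (t j - prevVal t j)) ^ (-(n : ℝ) / 2)) *
      exp (-∑ j, ‖increment n k j y‖ ^ 2 / (4 * (t j - prevVal t j))) := by
  unfold heatDensity heatKernel
  rw [Finset.prod_mul_distrib, ← exp_sum, ← Finset.sum_neg_distrib]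
  simp only [increment_apply, norm_sub_rev (prevVal y _), neg_div]

lemma heatDensity_pos {n k : ℕ} {t : Fin k → ℝ} (hs : ∀ j, 0 < t j - prevVal t j)
    (y : Fin k → EuclideanSpace ℝ (Fin n)) : 0 < heatDensity n k t y := by
  rw [heatDensity_eq]
  have : ∀ j, 0 < (4 * π * (t j - prevVal t j)) ^ (-(n : ℝ) / 2) := fun j =>
    rpow_pos_of_pos (mul_pos (by positivity) (hs j)) _
  exact mul_pos (Finset.prod_pos fun j _ => this j) (exp_pos _)

/-- The heat density has Gaussian decay. -/
lemma exists_heatDensity_le {n k : ℕ} {t : Fin k → ℝ} (hs : ∀ j, 0 < t j - prevVal t j) :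
    ∃ C ε : ℝ, 0 < ε ∧
      ∀ y, |heatDensity n k t y| ≤ C * exp (-(ε * ‖y‖ ^ 2)) := by
  obtain ⟨c, hc, hle⟩ := exists_norm_sq_le_sum_increment_sq n k
  set T : ℝ := 1 + ∑ j, 4 * (t j - prevVal t j)
  have hT : ∀ j, 4 * (t j - prevVal t j) ≤ T := fun j => by
    have := Finset.single_le_sum (f := fun j => 4 * (t j - prevVal t j))
      (fun i _ => by linarith [hs i]) (Finset.mem_univ j)
    linarith
  have hT0 : 0 < T := by
    have : 0 ≤ ∑ j, 4 * (t j - prevVal t j) := Finset.sum_nonneg fun i _ => by linarith [hs i]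
    linarith
  refine ⟨∏ j, (4 * π * (t j - prevVal t j)) ^ (-(n : ℝ) / 2), c / T, by positivity, fun y => ?_⟩
  rw [abs_of_pos (heatDensity_pos hs y), heatDensity_eq]
  refine mul_le_mul_of_nonneg_left (exp_le_exp.2 (neg_le_neg ?_))
    (Finset.prod_nonneg fun j _ => rpow_nonneg (mul_nonneg (by positivity) (hs j).le) _)
  calc c / T * ‖y‖ ^ 2 = c * ‖y‖ ^ 2 / T := by ring
    _ ≤ (∑ j, ‖increment n k j y‖ ^ 2) / T := by gcongr; exact hle y
    _ = ∑ j, ‖increment n k j y‖ ^ 2 / T := Finset.sum_div _ _ _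
    _ ≤ _ := Finset.sum_le_sum fun j _ =>
      div_le_div_of_nonneg_left (by positivity) (by linarith [hs j]) (hT j)

/-- The derivative of the quadratic form `-log ρ` along `v`, as a continuous linear functional. -/
noncomputable def heatScore (n k : ℕ) (t : Fin k → ℝ) (v : Fin k → EuclideanSpace ℝ (Fin n)) :
    (Fin k → EuclideanSpace ℝ (Fin n)) →L[ℝ] ℝ :=
  ∑ j, (2 * (t j - prevVal t j))⁻¹ • (innerSL ℝ (increment n k j v)).comp (increment n k j)

lemma heatScore_apply (n k : ℕ) (t : Fin k → ℝ) (v y : Fin k → EuclideanSpace ℝ (Fin n)) :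
    heatScore n k t v y = ∑ j, (2 * (t j - prevVal t j))⁻¹ *
      inner ℝ (increment n k j v) (increment n k j y) := by
  simp [heatScore]

lemma hasFDerivAt_heatDensity (n k : ℕ) (t : Fin k → ℝ)
    (y : Fin k → EuclideanSpace ℝ (Fin n)) :
    HasFDerivAt (heatDensity n k t) (-(heatDensity n k t y • heatScore n k t y)) y := by
  have hQ : HasFDerivAt (fun y => ∑ j, ‖increment n k j y‖ ^ 2 / (4 * (t j - prevVal t j)))
      (heatScore n k t y) y := by
    unfold heatScore
    refine HasFDerivAt.fun_sum fun j _ => ?_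
    have := ((increment n k j).hasFDerivAt (x := y)).norm_sq.mul_const
      (4 * (t j - prevVal t j))⁻¹
    simp only [div_eq_mul_inv]
    refine this.congr_fderiv ?_
    ext z
    simp
    ring
  have := (hQ.neg.exp).const_mul (∏ j, (4 * π * (t j - prevVal t j)) ^ (-(n : ℝ) / 2))
  rw [show heatDensity n k t = _ from funext (heatDensity_eq n k t)]
  refine this.congr_fderiv ?_
  ext z
  simp
  ring

lemma differentiable_heatDensity (n k : ℕ) (t : Fin k → ℝ) :
    Differentiable ℝ (heatDensity n k t) := fun y =>
  (hasFDerivAt_heatDensity n k t y).differentiableAt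

lemma fderiv_heatDensity_apply (n k : ℕ) (t : Fin k → ℝ)
    (y v : Fin k → EuclideanSpace ℝ (Fin n)) :
    fderiv ℝ (heatDensity n k t) y v = -(heatScore n k t v y * heatDensity n k t y) := by
  rw [(hasFDerivAt_heatDensity n k t y).fderiv]
  simp only [neg_apply, smul_apply, heatScore_apply,
    smul_eq_mul, real_inner_comm (increment n k _ v)]
  ring

lemma heatScore_smul_single (n k : ℕ) (t a : Fin k → ℝ) (α : Fin n) :
    heatScore n k t (fun j => a j • EuclideanSpace.single α 1)
        (fun j => a j • EuclideanSpace.single α 1) =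
      1 / 2 * ∑ j, (a j - prevVal a j) ^ 2 / (t j - prevVal t j) := by
  rw [heatScore_apply, Finset.mul_sum]
  refine Finset.sum_congr rfl fun j _ => ?_
  rw [increment_smul_const, real_inner_self_eq_norm_sq, norm_smul, mul_pow, norm_eq_abs, sq_abs]
  simp
  ring

lemma integral_heatMeasure {n k : ℕ} {t : Fin k → ℝ} (hs : ∀ j, 0 < t j - prevVal t j)
    (g : (Fin k → EuclideanSpace ℝ (Fin n)) → ℝ) :
    ∫ y, g y ∂(heatMeasure n k t) = ∫ y, g y * heatDensity n k t y := by
  unfold heatMeasure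
  rw [integral_withDensity_eq_integral_toReal_smul
    ((differentiable_heatDensity n k t).continuous.measurable.ennreal_ofReal)
    (.of_forall fun y => ENNReal.ofReal_lt_top)]
  simp only [ENNReal.toReal_ofReal (heatDensity_pos hs _).le, smul_eq_mul, mul_comm]

lemma isFiniteMeasure_heatMeasure {n k : ℕ} {t : Fin k → ℝ} (hs : ∀ j, 0 < t j - prevVal t j) :
    IsFiniteMeasure (heatMeasure n k t) := by
  obtain ⟨C, ε, hε, hdecay⟩ := exists_heatDensity_le (n := n) hs
  have hint : Integrable (fun y => 1 * heatDensity n k t y) :=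
    (continuous_const (y := (1 : ℝ))).integrable_mul_of_quadratic_growth
      (differentiable_heatDensity n k t).continuous hε hdecay (A := 1) fun y => by
        rw [abs_one, one_mul]
        exact one_le_pow₀ (by linarith [norm_nonneg y])
  simp only [one_mul] at hint
  exact isFiniteMeasure_withDensity_ofReal hint.2

lemma partialGrad_apply {n k : ℕ} {f : (Fin k → EuclideanSpace ℝ (Fin n)) → ℝ}
    (hf : Differentiable ℝ f) (j : Fin k) (y : Fin k → EuclideanSpace ℝ (Fin n)) :
    partialGrad n k f j y = (InnerProductSpace.toDual ℝ (EuclideanSpace ℝ (Fin n))).symm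
      ((fderiv ℝ f y).comp
        (ContinuousLinearMap.single ℝ (fun _ : Fin k => EuclideanSpace ℝ (Fin n)) j)) := by
  unfold partialGrad gradient
  congr 1
  have h := (hf (Function.update y j (y j))).hasFDerivAt.comp (y j)
    (hasFDerivAt_update (𝕜 := ℝ) y (i := j) (y j))
  rw [Function.update_eq_self] at h
  refine (HasFDerivAt.fderiv h).trans (congrArg _ ?_)
  ext z i : 2
  rcases eq_or_ne i j with rfl | hij
  · simp
  · simp [hij]

lemma partialGrad_coord {n k : ℕ} {f : (Fin k → EuclideanSpace ℝ (Fin n)) → ℝ}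
    (hf : Differentiable ℝ f) (j : Fin k) (y : Fin k → EuclideanSpace ℝ (Fin n)) (α : Fin n) :
    partialGrad n k f j y α = fderiv ℝ f y (Pi.single j (EuclideanSpace.single α 1)) := by
  have : partialGrad n k f j y α
      = inner ℝ (partialGrad n k f j y) (EuclideanSpace.single α (1 : ℝ)) := by
    simp [EuclideanSpace.inner_single_right]
  rw [this, partialGrad_apply hf, InnerProductSpace.toDual_symm_apply]
  rfl

lemma smul_const_eq_sum_single {n k : ℕ} (a : Fin k → ℝ) (w : EuclideanSpace ℝ (Fin n)) :
    (fun j => a j • w) = ∑ j, a j • (Pi.single j w : Fin k → EuclideanSpace ℝ (Fin n)) := by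
  rw [← Finset.univ_sum_single (fun j => a j • w)]
  simp only [Pi.single_smul]

/-- the sharp-constant differential Harnack inequality on path space of `ℝⁿ` for
cylinder functions, with coefficients `a₁,…,a_k` (convention `a₀ = 0`, `t₀ = 0`). -/
theorem sharp_differential_harnack_euclidean_path_space
    (n k : ℕ) (hn : 1 ≤ n) (hk : 1 ≤ k)
    (t : Fin k → ℝ) (hmono : StrictMono t) (hpos : ∀ j, 0 < t j)
    (f : (Fin k → EuclideanSpace ℝ (Fin n)) → ℝ)
    (hf : ContDiff ℝ 2 f) (hfpos : ∀ y, 0 < f y)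
    (M : ℝ) (hbd : ∀ y, |f y| ≤ M ∧ ‖fderiv ℝ f y‖ ≤ M ∧ ‖iteratedFDeriv ℝ 2 f y‖ ≤ M)
    (a : Fin k → ℝ) :
    (∑ i : Fin k, ∑ j : Fin k, a i * a j *
        ∫ y, ∑ α : Fin n, partialHess n k f i j y
            (EuclideanSpace.single α (1 : ℝ)) (EuclideanSpace.single α (1 : ℝ))
          ∂(heatMeasure n k t)) /
      (∫ y, f y ∂(heatMeasure n k t))
    - ‖∑ j : Fin k, a j •
        (∫ y, partialGrad n k f j y ∂(heatMeasure n k t))‖ ^ 2 /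
      (∫ y, f y ∂(heatMeasure n k t)) ^ 2
    + ((n : ℝ) / 2) * ∑ j : Fin k, (a j - prevVal a j) ^ 2 / (t j - prevVal t j) ≥ 0 := by
  have hs := sub_prevVal_pos hmono hpos
  have := isFiniteMeasure_heatMeasure (n := n) hs
  obtain ⟨C, ε, hε, hdecay⟩ := exists_heatDensity_le (n := n) hs
  have hdiff : Differentiable ℝ f := hf.differentiable (by norm_num)
  have hf1 : Continuous (fderiv ℝ f) := hf.continuous_fderiv (by norm_num)
  have hf2 : Continuous (iteratedFDeriv ℝ 2 f) := hf.continuous_iteratedFDeriv le_rfl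
  set μ := heatMeasure n k t with hμ
  let v : Fin n → Fin k → EuclideanSpace ℝ (Fin n) :=
    fun α j => a j • EuclideanSpace.single α (1 : ℝ)
  have hgradint : ∀ j, Integrable (partialGrad n k f j) μ := by
    intro j
    rw [show partialGrad n k f j = _ from funext (partialGrad_apply hdiff j)]
    refine Integrable.of_bound (C := M * ‖ContinuousLinearMap.single ℝ
      (fun _ : Fin k => EuclideanSpace ℝ (Fin n)) j‖) (Continuous.aestronglyMeasurable ?_)
      (.of_forall fun y => ?_)
    · exact (LinearIsometryEquiv.continuous _).comp (hf1.clm_comp continuous_const)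
    · rw [LinearIsometryEquiv.norm_map]
      exact (ContinuousLinearMap.opNorm_comp_le _ _).trans (by gcongr; exact (hbd y).2.1)
  have hfderivint : ∀ w, Integrable (fun y => fderiv ℝ f y w) μ := fun w =>
    Integrable.of_bound (C := M * ‖w‖) (hf1.clm_apply continuous_const).aestronglyMeasurable
      (.of_forall fun y => ((fderiv ℝ f y).le_opNorm w).trans (by gcongr; exact (hbd y).2.1))
  have hhessint : ∀ w, Integrable (fun y => iteratedFDeriv ℝ 2 f y w) μ := fun w =>
    Integrable.of_bound (C := M * ∏ i, ‖w i‖) (hf2.eval_const w).aestronglyMeasurable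
      (.of_forall fun y => ((iteratedFDeriv ℝ 2 f y).le_opNorm w).trans
        (by gcongr; exact (hbd y).2.2))
  have hgrad : ∀ α, (∑ j, a j • ∫ y, partialGrad n k f j y ∂μ) α
      = ∫ y, fderiv ℝ f y (v α) ∂μ := by
    intro α
    have hcoord : ∀ j, (∫ y, partialGrad n k f j y ∂μ) α
        = ∫ y, fderiv ℝ f y (Pi.single j (EuclideanSpace.single α 1)) ∂μ := by
      intro j
      simp only [← partialGrad_coord hdiff]
      exact ((EuclideanSpace.proj (𝕜 := ℝ) α).integral_comp_comm (hgradint j)).symm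
    simp only [v, smul_const_eq_sum_single, map_sum, map_smul, smul_eq_mul]
    rw [integral_finsetSum _ fun j _ => (hfderivint _).const_mul _]
    simp [hcoord, integral_const_mul]
  have hhess : ∑ i : Fin k, ∑ j : Fin k, a i * a j *
      ∫ y, ∑ α : Fin n, partialHess n k f i j y
        (EuclideanSpace.single α (1 : ℝ)) (EuclideanSpace.single α (1 : ℝ)) ∂μ
      = ∑ α, ∫ y, iteratedFDeriv ℝ 2 f y ![v α, v α] ∂μ := by
    have hexpand : ∀ α y, iteratedFDeriv ℝ 2 f y ![v α, v α] = ∑ i, ∑ j, a i * a j *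
        partialHess n k f i j y (EuclideanSpace.single α 1) (EuclideanSpace.single α 1) := by
      intro α y
      simp only [v, smul_const_eq_sum_single, partialHess, iteratedFDeriv_two_apply,
        Matrix.cons_val_zero, Matrix.cons_val_one, map_sum, map_smul, sum_apply, smul_apply,
        smul_eq_mul, Finset.mul_sum, mul_assoc]
      rw [Finset.sum_comm]
      simp only [mul_left_comm]
    have hint : ∀ i j α, Integrable (fun y => partialHess n k f i j y
        (EuclideanSpace.single α 1) (EuclideanSpace.single α 1)) μ := fun i j α => hhessint _
    simp only [hexpand]
    have hright : ∀ α, ∫ y, ∑ i, ∑ j, a i * a j * partialHess n k f i j y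
          (EuclideanSpace.single α 1) (EuclideanSpace.single α 1) ∂μ
        = ∑ i, ∑ j, a i * a j * ∫ y, partialHess n k f i j y
          (EuclideanSpace.single α 1) (EuclideanSpace.single α 1) ∂μ := by
      intro α
      rw [integral_finsetSum _ fun i _ => integrable_finsetSum _ fun j _ =>
        (hint i j α).const_mul _]
      refine Finset.sum_congr rfl fun i _ => ?_
      rw [integral_finsetSum _ fun j _ => (hint i j α).const_mul _]
      simp only [integral_const_mul]
    simp only [hright, integral_finsetSum _ fun α _ => hint _ _ α, Finset.mul_sum]
    rw [Finset.sum_comm_cycle]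
  have hmain := Finset.sum_nonneg fun α (_ : α ∈ Finset.univ) =>
    directional_harnack_of_gaussian_decay volume (differentiable_heatDensity n k t)
      (heatDensity_pos hs) hε hdecay (v α) (heatScore n k t (v α))
      (fun y => fderiv_heatDensity_apply n k t y (v α)) hf hfpos (fun y => (hbd y).1)
      (fun y => (hbd y).2.1) (fun y => (hbd y).2.2)
  simp only [← integral_heatMeasure hs, ← hμ] at hmain
  rw [hhess, EuclideanSpace.norm_sq_eq]
  simp only [hgrad, norm_eq_abs, sq_abs]
  simp only [v, heatScore_smul_single, Finset.sum_add_distrib, Finset.sum_sub_distrib,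
    ← Finset.sum_div, Finset.sum_const, Finset.card_univ, Fintype.card_fin, nsmul_eq_mul] at hmain
  refine hmain.trans_eq ?_
  ring
end
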